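/- On the Heisenberg group ℍ₁: (i) the Carnot–Carathéodory distance to the identity x ↦ d(x) is differentiable at every point x = (x₁,x₂,x₃) with (x₁,x₂) ≠ (0,0), and there (X₁d(x))² + (X₂d(x))² = 1; (ii) there exists a constant K > 0 such that Δd ≤ K/d in the distributional sense, i.e. ∫_{ℝ³} d(x)·(Δψ)(x) dx ≤ ∫_{ℝ³} (K/d(x))·ψ(x) dx for every nonnegative smooth compactly supported ψ: ℝ³ → ℝ. -/

import Mathlib

open MeasureTheory Filter

noncomputable section

/-- Action of the vector field with coefficient functions `a` on `f`:
`X f (x) = ∑ j a_j(x) ∂f/∂x_j (x)`. -/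
def Xop {m : ℕ} (a : (Fin m → ℝ) → Fin m → ℝ) (f : (Fin m → ℝ) → ℝ) (x : Fin m → ℝ) : ℝ :=
  ∑ j : Fin m, a x j * fderiv ℝ f x (Pi.single j 1)

/-- `‖∇f‖² = ∑ₖ (Xᵏ f)²` for the Hörmander system with coefficients `a`. -/
def gradSq {m n : ℕ} (a : Fin n → (Fin m → ℝ) → Fin m → ℝ) (f : (Fin m → ℝ) → ℝ)
    (x : Fin m → ℝ) : ℝ :=
  ∑ k : Fin n, Xop (a k) f x ^ 2

/-- The sublaplacian `Δf = ∑ₖ Xᵏ(Xᵏ f)`. -/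
def subLap {m n : ℕ} (a : Fin n → (Fin m → ℝ) → Fin m → ℝ) (f : (Fin m → ℝ) → ℝ)
    (x : Fin m → ℝ) : ℝ :=
  ∑ k : Fin n, Xop (a k) (Xop (a k) f) x

/-- Expectation of `f` under the probability measure `e^{-H(x)} dx / Z`. -/
def gibbsInt {m : ℕ} (H : (Fin m → ℝ) → ℝ) (f : (Fin m → ℝ) → ℝ) : ℝ :=
  (∫ x, f x * Real.exp (-H x)) / ∫ x, Real.exp (-H x)

/-- The Hörmander system `X₁ = ∂₁ - (x₂/2)∂₃`, `X₂ = ∂₂ + (x₁/2)∂₃` of the Heisenberg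
group `ℍ₁ ≅ ℝ³`, given through its coefficient functions. -/
def heisA : Fin 2 → (Fin 3 → ℝ) → Fin 3 → ℝ :=
  fun k x => if k = 0 then ![1, 0, -x 1 / 2] else ![0, 1, x 0 / 2]

/-- The Carnot–Carathéodory distance on `ℍ₁`: the infimum of lengths of admissible
(horizontal) Lipschitz curves joining `x` to `y`. -/
def ccDist (x y : Fin 3 → ℝ) : ℝ :=
  sInf {L : ℝ | ∃ (γ : ℝ → Fin 3 → ℝ) (cf : ℝ → Fin 2 → ℝ) (K : NNReal),
    LipschitzOnWith K γ (Set.Icc 0 1) ∧ γ 0 = x ∧ γ 1 = y ∧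
    (∀ k, Measurable fun s => cf s k) ∧
    (∀ᵐ s ∂(volume.restrict (Set.Icc (0 : ℝ) 1)),
      HasDerivAt γ (∑ k, cf s k • heisA k (γ s)) s) ∧
    L = ∫ s in Set.Icc (0 : ℝ) 1, Real.sqrt (∑ k, cf s k ^ 2)}

/-- Carnot–Carathéodory distance to the identity `e = 0` of `ℍ₁`. -/
def dH (x : Fin 3 → ℝ) : ℝ := ccDist x 0

namespace Heisenberg

open Real Set

/-- The function `φ ↦ φ cot φ`, extended by `1` at `0`. -/
def phiCot (φ : ℝ) : ℝ := cos φ / sinc φ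

/-- The ratio `4 |area| / chord²` of a circular segment of half-angle `φ`. -/
def areaRatio (φ : ℝ) : ℝ := (φ - sin φ * cos φ) / sin φ ^ 2

lemma sinc_mul_self (φ : ℝ) : sinc φ * φ = sin φ := by
  by_cases h : φ = 0
  · simp [h]
  · rw [sinc_of_ne_zero h]; field_simp

lemma sinc_pos_of_mem {φ : ℝ} (h : φ ∈ Ioo (-π) π) : 0 < sinc φ := by
  rcases lt_trichotomy φ 0 with h0 | h0 | h0
  · rw [sinc_of_ne_zero h0.ne]
    exact div_pos_of_neg_of_neg (sin_neg_of_neg_of_neg_pi_lt h0 h.1) h0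
  · simp [h0]
  · rw [sinc_of_ne_zero h0.ne']
    exact div_pos (sin_pos_of_pos_of_lt_pi h0 h.2) h0

lemma sin_ne_zero_of_mem {φ : ℝ} (h : φ ∈ Ioo (-π) π) (h0 : φ ≠ 0) : sin φ ≠ 0 := by
  rw [← sinc_mul_self]
  exact mul_ne_zero (sinc_pos_of_mem h).ne' h0

lemma phiCot_neg (φ : ℝ) : phiCot (-φ) = phiCot φ := by simp [phiCot]

lemma phiCot_zero : phiCot 0 = 1 := by simp [phiCot]

lemma phiCot_abs (φ : ℝ) : phiCot |φ| = phiCot φ := by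
  rcases abs_choice φ with h | h <;> simp [h, phiCot_neg]

lemma phiCot_mul_sin {φ : ℝ} (h : φ ∈ Ioo (-π) π) : phiCot φ * sin φ = φ * cos φ := by
  have := (sinc_pos_of_mem h).ne'
  rw [phiCot, ← sinc_mul_self]; field_simp

lemma continuousOn_phiCot : ContinuousOn phiCot (Ioo (-π) π) :=
  continuous_cos.continuousOn.div continuous_sinc.continuousOn fun _ h => (sinc_pos_of_mem h).ne'

lemma sq_add_phiCot_sq {φ : ℝ} (h : φ ∈ Ioo (-π) π) :
    φ ^ 2 + phiCot φ ^ 2 = (1 / sinc φ) ^ 2 := by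
  have := (sinc_pos_of_mem h).ne'
  have h2 := sin_sq_add_cos_sq φ
  rw [← sinc_mul_self] at h2
  rw [phiCot]; field_simp
  linear_combination h2

lemma phiCot_add_mul_areaRatio {φ : ℝ} (h : φ ∈ Ioo (-π) π) :
    phiCot φ + φ * areaRatio φ = (1 / sinc φ) ^ 2 := by
  by_cases h0 : φ = 0
  · simp [h0, phiCot_zero]
  have := sin_ne_zero_of_mem h h0
  rw [phiCot, areaRatio, sinc_of_ne_zero h0]
  field_simp
  ring

lemma mul_cos_lt_sin {φ : ℝ} (h0 : 0 < φ) (h : φ < π) : φ * cos φ < sin φ := by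
  have hm : StrictMonoOn (fun x : ℝ => sin x - x * cos x) (Icc 0 π) := by
    refine strictMonoOn_of_deriv_pos (convex_Icc _ _) (by fun_prop) fun x hx => ?_
    rw [interior_Icc] at hx
    have : HasDerivAt (fun x : ℝ => sin x - x * cos x)
        (cos x - (1 * cos x + x * (-sin x))) x :=
      (hasDerivAt_sin x).sub ((hasDerivAt_id x).mul (hasDerivAt_cos x))
    rw [this.deriv]
    have := mul_pos hx.1 (sin_pos_of_pos_of_lt_pi hx.1 hx.2)
    linarith
  have := hm (left_mem_Icc.2 pi_pos.le) ⟨h0.le, h.le⟩ h0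
  simp at this
  linarith

lemma two_mul_mul_sin_sq_le {φ : ℝ} (h0 : 0 ≤ φ) (h : φ < π) :
    2 * φ * sin φ ^ 2 ≤ 3 * (φ - sin φ * cos φ) := by
  have hm : MonotoneOn (fun x : ℝ => 3 * (x - sin x * cos x) - 2 * x * sin x ^ 2) (Icc 0 π) := by
    refine monotoneOn_of_deriv_nonneg (convex_Icc _ _) (by fun_prop) (by fun_prop) fun x hx => ?_
    rw [interior_Icc] at hx
    have : HasDerivAt (fun x : ℝ => 3 * (x - sin x * cos x) - 2 * x * sin x ^ 2)
        (3 * (1 - (cos x * cos x + sin x * (-sin x))) -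
          (2 * 1 * sin x ^ 2 + 2 * x * ((2 : ℕ) * sin x ^ (2 - 1) * cos x))) x :=
      (((hasDerivAt_id x).sub ((hasDerivAt_sin x).mul (hasDerivAt_cos x))).const_mul 3).sub
        (((hasDerivAt_id x).const_mul 2).mul ((hasDerivAt_sin x).pow 2))
    rw [this.deriv]
    have := mul_pos (sin_pos_of_pos_of_lt_pi hx.1 hx.2) (sub_pos.2 (mul_cos_lt_sin hx.1 hx.2))
    have h2 := sin_sq_add_cos_sq x
    norm_num
    nlinarith
  have := hm (left_mem_Icc.2 pi_pos.le) ⟨h0, h.le⟩ h0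
  simp at this
  linarith

lemma hasDerivAt_phiCot {φ : ℝ} (h0 : 0 < φ) (h : φ < π) :
    HasDerivAt phiCot (-areaRatio φ) φ := by
  have hs : sin φ ≠ 0 := (sin_pos_of_pos_of_lt_pi h0 h).ne'
  have h1 : HasDerivAt (fun x : ℝ => x * cos x / sin x)
      (((1 * cos φ + φ * (-sin φ)) * sin φ - φ * cos φ * cos φ) / sin φ ^ 2) φ :=
    ((hasDerivAt_id φ).mul (hasDerivAt_cos φ)).div (hasDerivAt_sin φ) hs
  have h2 : phiCot =ᶠ[nhds φ] fun x : ℝ => x * cos x / sin x := by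
    filter_upwards [lt_mem_nhds h0, gt_mem_nhds h] with x hx0 hx
    rw [phiCot, sinc_of_ne_zero hx0.ne']; field_simp
  refine (h1.congr_of_eventuallyEq h2).congr_deriv ?_
  rw [areaRatio, ← neg_div]
  congr 1
  linear_combination (-φ) * sin_sq_add_cos_sq φ

lemma two_thirds_le_areaRatio {φ : ℝ} (h0 : 0 < φ) (h : φ < π) : 2 / 3 * φ ≤ areaRatio φ := by
  have hs := sin_pos_of_pos_of_lt_pi h0 h
  rw [areaRatio, le_div_iff₀ (by positivity)]
  linarith [two_mul_mul_sin_sq_le h0.le h]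

lemma phiCot_sub_ge {δ m : ℝ} (hδ : 0 ≤ δ) (hm : δ ≤ m) (h : m < π) :
    (m ^ 2 - δ ^ 2) / 3 ≤ phiCot δ - phiCot m := by
  have hm' : AntitoneOn (fun x : ℝ => phiCot x + x ^ 2 / 3) (Ico 0 π) := by
    have hd : ∀ x ∈ Ioo (0 : ℝ) π, HasDerivAt (fun x : ℝ => phiCot x + x ^ 2 / 3)
        (-areaRatio x + (2 : ℕ) * x ^ (2 - 1) / 3) x := fun x hx =>
      (hasDerivAt_phiCot hx.1 hx.2).add ((hasDerivAt_pow 2 x).div_const 3)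
    refine antitoneOn_of_deriv_nonpos (convex_Ico _ _) ?_ ?_ fun x hx => ?_
    · refine (continuousOn_phiCot.mono fun x hx => ?_).add (by fun_prop)
      exact ⟨by linarith [pi_pos, hx.1], hx.2⟩
    · rw [interior_Ico]
      exact fun x hx => (hd x hx).differentiableAt.differentiableWithinAt
    · rw [interior_Ico] at hx
      rw [(hd x hx).deriv]
      have := two_thirds_le_areaRatio hx.1 hx.2
      norm_num
      linarith
  have := hm' ⟨hδ, hm.trans_lt h⟩ ⟨hδ.trans hm, h⟩ hm
  simp only at this
  linarith

lemma phiCot_le_one {φ : ℝ} (h : φ ∈ Ioo (-π) π) : phiCot φ ≤ 1 := by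
  have := phiCot_sub_ge le_rfl (abs_nonneg φ) (abs_lt.2 h)
  rw [phiCot_zero, phiCot_abs] at this
  nlinarith [sq_nonneg |φ|]

lemma areaRatio_neg (φ : ℝ) : areaRatio (-φ) = -areaRatio φ := by
  simp only [areaRatio, sin_neg, cos_neg]; ring

lemma areaRatio_zero : areaRatio 0 = 0 := by simp [areaRatio]

lemma areaRatio_le_tan {φ : ℝ} (h0 : 0 ≤ φ) (h : φ < π / 2) : areaRatio φ ≤ tan φ := by
  rcases h0.eq_or_lt with rfl | h0
  · simp [areaRatio]
  have hs := sin_pos_of_pos_of_lt_pi h0 (by linarith [pi_pos])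
  have hc : 0 < cos φ := cos_pos_of_mem_Ioo ⟨by linarith, h⟩
  have ht := le_tan h0.le h
  rw [areaRatio, div_le_iff₀ (by positivity)]
  have : tan φ * sin φ ^ 2 = tan φ - sin φ * cos φ := by
    rw [tan_eq_sin_div_cos]; field_simp
    linear_combination sin_sq_add_cos_sq φ
  linarith

lemma continuousAt_areaRatio {φ : ℝ} (h : φ ∈ Ioo (-π) π) : ContinuousAt areaRatio φ := by
  by_cases h0 : φ = 0
  · subst h0
    have hb : ∀ x ∈ Ioo (-(π / 2)) (π / 2), |areaRatio x| ≤ |tan x| := by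
      have key : ∀ x : ℝ, 0 ≤ x → x < π / 2 → |areaRatio x| ≤ |tan x| := by
        intro x hx0 hx
        rcases hx0.eq_or_lt with rfl | hx0
        · simp [areaRatio]
        rw [abs_of_nonneg (le_trans (by positivity)
          (two_thirds_le_areaRatio hx0 (by linarith [pi_pos])))]
        exact (areaRatio_le_tan hx0.le hx).trans (le_abs_self _)
      intro x hx
      rcases le_total 0 x with h | h
      · exact key x h hx.2
      · have := key (-x) (by linarith) (by linarith [hx.1])
        simpa [areaRatio_neg, tan_neg] using this
    rw [ContinuousAt, areaRatio_zero]
    have ht : Tendsto (fun x : ℝ => |tan x|) (nhds 0) (nhds 0) := by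
      have : ContinuousAt (fun x : ℝ => |tan x|) 0 :=
        (continuousAt_tan.2 (by simp)).abs
      simpa [ContinuousAt] using this
    refine squeeze_zero_norm' ?_ ht
    filter_upwards [Ioo_mem_nhds (show -(π / 2) < 0 by linarith [pi_pos])
      (show 0 < π / 2 by linarith [pi_pos])] with x hx using hb x hx
  · have := sin_ne_zero_of_mem h h0
    unfold areaRatio
    exact ContinuousAt.div (by fun_prop) (by fun_prop) (by positivity)

lemma strictMonoOn_areaRatio_Ico : StrictMonoOn areaRatio (Ico 0 π) := by
  refine strictMonoOn_of_deriv_pos (convex_Ico _ _) (fun x hx =>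
    (continuousAt_areaRatio ⟨by linarith [pi_pos, hx.1], hx.2⟩).continuousWithinAt) fun x hx => ?_
  rw [interior_Ico] at hx
  have hs := sin_pos_of_pos_of_lt_pi hx.1 hx.2
  have hd : HasDerivAt areaRatio
      (((1 - (cos x * cos x + sin x * (-sin x))) * sin x ^ 2 -
        (x - sin x * cos x) * ((2 : ℕ) * sin x ^ (2 - 1) * cos x)) / (sin x ^ 2) ^ 2) x :=
    ((hasDerivAt_id x).sub ((hasDerivAt_sin x).mul (hasDerivAt_cos x))).div
      ((hasDerivAt_sin x).pow 2) (by positivity)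
  rw [hd.deriv]
  refine div_pos ?_ (by positivity)
  have := mul_pos hs (sub_pos.2 (mul_cos_lt_sin hx.1 hx.2))
  have h2 := sin_sq_add_cos_sq x
  have h3 : (1 - (cos x * cos x + sin x * (-sin x))) * sin x ^ 2 -
      (x - sin x * cos x) * ((2 : ℕ) * sin x ^ (2 - 1) * cos x)
      = 2 * (sin x * (sin x - x * cos x)) := by
    norm_num
    linear_combination (-sin x ^ 2 + 2 * sin x ^ 2) * h2
  rw [h3]; positivity

lemma strictMonoOn_areaRatio : StrictMonoOn areaRatio (Ioo (-π) π) := by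
  intro x hx y hy hxy
  rcases le_or_gt 0 x with h | h
  · exact strictMonoOn_areaRatio_Ico ⟨h, hx.2⟩ ⟨h.trans hxy.le, hy.2⟩ hxy
  have key : ∀ z w : ℝ, -π < z → z < w → w ≤ 0 → areaRatio z < areaRatio w := by
    intro z w hz hzw hw
    have := strictMonoOn_areaRatio_Ico (a := -w) (b := -z) ⟨by linarith, by linarith⟩
      ⟨by linarith, by linarith⟩ (by linarith)
    simp only [areaRatio_neg] at this
    linarith
  rcases le_or_gt y 0 with h' | h'
  · exact key x y hx.1 hxy h'
  · exact (key x 0 hx.1 h le_rfl).trans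
      (strictMonoOn_areaRatio_Ico ⟨le_rfl, pi_pos⟩ ⟨h'.le, hy.2⟩ h')

lemma exists_areaRatio_eq (b : ℝ) : ∃ φ ∈ Ioo (-π) π, areaRatio φ = b := by
  have key : ∀ b : ℝ, 0 ≤ b → ∃ φ ∈ Ioo (-π) π, areaRatio φ = b := by
    intro b hb
    have : ∀ᶠ x in nhds π, b * sin x ^ 2 < x - sin x * cos x :=
      ContinuousAt.eventually_lt (f := fun x => b * sin x ^ 2) (g := fun x => x - sin x * cos x)
        (by fun_prop) (by fun_prop) (by simp [pi_pos])
    obtain ⟨ψ, hψ, h0, h1⟩ := ((this.filter_mono nhdsWithin_le_nhds).and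
      (Ioo_mem_nhdsLT pi_pos)).exists
    have hs := sin_pos_of_pos_of_lt_pi h0 h1
    have hle : b ≤ areaRatio ψ := by
      rw [areaRatio, le_div_iff₀ (by positivity)]; exact hψ.le
    obtain ⟨φ, hφ, e⟩ := intermediate_value_Icc h0.le (f := areaRatio)
      (fun x hx => (continuousAt_areaRatio
        ⟨by linarith [pi_pos, hx.1], hx.2.trans_lt h1⟩).continuousWithinAt)
      (show b ∈ _ from ⟨by rwa [areaRatio_zero], hle⟩)
    exact ⟨φ, ⟨by linarith [pi_pos, hφ.1], hφ.2.trans_lt h1⟩, e⟩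
  rcases le_total 0 b with h | h
  · exact key b h
  · obtain ⟨φ, hφ, e⟩ := key (-b) (by linarith)
    exact ⟨-φ, ⟨by linarith [hφ.2], by linarith [hφ.1]⟩, by rw [areaRatio_neg, e, neg_neg]⟩

/-- `areaRatio` as an order isomorphism. -/
def areaRatioIso : Ioo (-π) π ≃o ℝ :=
  StrictMono.orderIsoOfSurjective (fun φ : Ioo (-π) π => areaRatio φ)
    (fun x y h => strictMonoOn_areaRatio x.2 y.2 h)
    fun b => let ⟨φ, hφ, e⟩ := exists_areaRatio_eq b; ⟨⟨φ, hφ⟩, e⟩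

/-- The inverse of `areaRatio`. -/
def halfAngle (b : ℝ) : ℝ := areaRatioIso.symm b

lemma halfAngle_mem (b : ℝ) : halfAngle b ∈ Ioo (-π) π := (areaRatioIso.symm b).2

lemma areaRatio_halfAngle (b : ℝ) : areaRatio (halfAngle b) = b :=
  areaRatioIso.apply_symm_apply b

lemma continuous_halfAngle : Continuous halfAngle :=
  continuous_subtype_val.comp areaRatioIso.symm.continuous

/-- Quantitative midpoint concavity of `φ ↦ φ cot φ`. -/
lemma phiCot_midpoint {p q : ℝ} (hp : p ∈ Ioo (-π) π) (hq : q ∈ Ioo (-π) π)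
    (hp0 : p ≠ 0) (hq0 : q ≠ 0) :
    0 ≤ 2 * phiCot ((p + q) / 2) - phiCot p - phiCot q ∧
    (phiCot p - phiCot q) ^ 2 + (p - q) ^ 2 ≤
      (2 * phiCot ((p + q) / 2) - phiCot p - phiCot q) * (8 - phiCot p - phiCot q) := by
  obtain ⟨m, hm⟩ : ∃ m, m = (p + q) / 2 := ⟨_, rfl⟩
  obtain ⟨δ, hδ⟩ : ∃ δ, δ = (p - q) / 2 := ⟨_, rfl⟩
  have ep : p = m + δ := by rw [hm, hδ]; ring
  have eq : q = m - δ := by rw [hm, hδ]; ring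
  have hδ' : p - q = 2 * δ := by rw [hδ]; ring
  have hmm : m ∈ Ioo (-π) π := ⟨by linarith [hp.1, hq.1], by linarith [hp.2, hq.2]⟩
  have hδm : δ ∈ Ioo (-π) π := ⟨by linarith [hp.1, hq.2], by linarith [hp.2, hq.1]⟩
  rw [← hm]
  have gp := phiCot_mul_sin hp
  have gq := phiCot_mul_sin hq
  have gm := phiCot_mul_sin hmm
  have gδ := phiCot_mul_sin hδm
  have gδ1 := phiCot_le_one hδm
  have p1 := sin_sq_add_cos_sq m
  have p2 := sin_sq_add_cos_sq δ
  have sp : sin p = sin m * cos δ + cos m * sin δ := by rw [ep, sin_add]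
  have sq : sin q = sin m * cos δ - cos m * sin δ := by rw [eq, sin_sub]
  have cp : cos p = cos m * cos δ - sin m * sin δ := by rw [ep, cos_add]
  have cq : cos q = cos m * cos δ + sin m * sin δ := by rw [eq, cos_sub]
  have hpq : p * q = m ^ 2 - δ ^ 2 := by rw [ep, eq]; ring
  have hN : sin p * sin q = sin m ^ 2 - sin δ ^ 2 := by
    rw [sp, sq]; linear_combination sin m ^ 2 * p2 - sin δ ^ 2 * p1
  have hN' : sin p * sin q = sinc p * sinc q * (m ^ 2 - δ ^ 2) := by
    rw [← sinc_mul_self, ← sinc_mul_self q, ← hpq]; ring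
  have hsum : cos p * sin q + cos q * sin p = 2 * sin m * cos m := by
    rw [sp, sq, cp, cq]; linear_combination 2 * sin m * cos m * p2
  have hdiff : cos p * sin q - cos q * sin p = -2 * sin δ * cos δ := by
    rw [sp, sq, cp, cq]; linear_combination (-2 * sin δ * cos δ) * p1
  have hcc : cos p * cos q = cos m ^ 2 - sin δ ^ 2 := by
    rw [cp, cq]; linear_combination cos m ^ 2 * p2 - sin δ ^ 2 * p1
  have hS : (phiCot p + phiCot q) * (sin p * sin q)
      = 2 * m * sin m * cos m - 2 * δ * sin δ * cos δ := by
    have : (phiCot p + phiCot q) * (sin p * sin q) = p * cos p * sin q + q * cos q * sin p := by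
      linear_combination sin q * gp + sin p * gq
    rw [this]
    linear_combination m * hsum + δ * hdiff + cos p * sin q * ep + cos q * sin p * eq
  have hP : phiCot p * phiCot q * (sin p * sin q) = (m ^ 2 - δ ^ 2) * (cos m ^ 2 - sin δ ^ 2) := by
    rw [← hpq, ← hcc]
    linear_combination phiCot q * sin q * gp + p * cos p * gq
  have I1 : (2 * phiCot m - phiCot p - phiCot q) * (sin p * sin q)
      = 2 * sin δ ^ 2 * (phiCot δ - phiCot m) := by
    have : (2 * phiCot m - phiCot p - phiCot q) * (sin p * sin q)
      = 2 * phiCot m * (sin m ^ 2 - sin δ ^ 2)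
        - (2 * m * sin m * cos m - 2 * δ * sin δ * cos δ) := by
      rw [← hN, ← hS]; ring
    rw [this]
    linear_combination 2 * sin m * gm - 2 * sin δ * gδ
  have I2 : ((2 * phiCot m - phiCot p - phiCot q) * (8 - phiCot p - phiCot q)
        - (phiCot p - phiCot q) ^ 2 - (p - q) ^ 2) * (sin p * sin q)
      = 4 * sin δ ^ 2 * ((phiCot δ - phiCot m) * (4 - phiCot δ) - (m ^ 2 - δ ^ 2)) := by
    have h1 : ((2 * phiCot m - phiCot p - phiCot q) * (8 - phiCot p - phiCot q)
        - (phiCot p - phiCot q) ^ 2 - (p - q) ^ 2) * (sin p * sin q)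
        = 8 * (2 * sin δ ^ 2 * (phiCot δ - phiCot m))
          - 2 * phiCot m * (2 * m * sin m * cos m - 2 * δ * sin δ * cos δ)
          + 4 * ((m ^ 2 - δ ^ 2) * (cos m ^ 2 - sin δ ^ 2))
          - 4 * δ ^ 2 * (sin m ^ 2 - sin δ ^ 2) := by
      rw [← I1, ← hS, ← hP, ← hN]
      linear_combination (-(p - q + 2 * δ) * (sin p * sin q)) * hδ'
    rw [h1]
    linear_combination (-4 * m * cos m) * gm + (-4 * phiCot m * sin δ + 4 * phiCot δ * sin δ
      + 4 * δ * cos δ) * gδ + 4 * δ ^ 2 * p2 - 4 * δ ^ 2 * p1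
  have hss := mul_pos (sinc_pos_of_mem hp) (sinc_pos_of_mem hq)
  have hs2 := sq_nonneg (sin δ)
  rcases lt_or_gt_of_ne (mul_ne_zero hp0 hq0) with hneg | hpos
  · rw [hpq] at hneg
    have hNn : sin p * sin q < 0 := by rw [hN']; exact mul_neg_of_pos_of_neg hss hneg
    have hle : |m| ≤ |δ| := sq_le_sq.1 (by linarith)
    have hg := phiCot_sub_ge (abs_nonneg m) hle (abs_lt.2 hδm)
    rw [phiCot_abs, phiCot_abs, sq_abs, sq_abs] at hg
    have h0 : 0 ≤ phiCot m - phiCot δ := by linarith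
    constructor
    · by_contra! hcon
      have := mul_pos_of_neg_of_neg hcon hNn
      rw [I1] at this
      linarith [mul_nonneg hs2 h0]
    · by_contra! hcon
      have := mul_nonneg h0 (sub_nonneg.2 gδ1)
      have h3 : 0 ≤ -((phiCot δ - phiCot m) * (4 - phiCot δ) - (m ^ 2 - δ ^ 2)) := by linarith
      have := mul_pos_of_neg_of_neg (sub_neg.2 hcon) hNn
      rw [← sub_sub, I2] at this
      linarith [mul_nonneg hs2 h3]
  · rw [hpq] at hpos
    have hNp : 0 < sin p * sin q := by rw [hN']; exact mul_pos hss hpos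
    have hle : |δ| ≤ |m| := sq_le_sq.1 (by linarith)
    have hg := phiCot_sub_ge (abs_nonneg δ) hle (abs_lt.2 hmm)
    rw [phiCot_abs, phiCot_abs, sq_abs, sq_abs] at hg
    have h0 : 0 ≤ phiCot δ - phiCot m := by linarith
    constructor
    · by_contra! hcon
      have := mul_neg_of_neg_of_pos hcon hNp
      rw [I1] at this
      linarith [mul_nonneg hs2 h0]
    · by_contra! hcon
      have := mul_nonneg h0 (sub_nonneg.2 gδ1)
      have h3 : 0 ≤ (phiCot δ - phiCot m) * (4 - phiCot δ) - (m ^ 2 - δ ^ 2) := by linarith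
      have := mul_neg_of_neg_of_pos (sub_neg.2 hcon) hNp
      rw [← sub_sub, I2] at this
      linarith [mul_nonneg hs2 h3]

/-- The value at `x` of the minimal magnetic action with Lagrange multiplier `φ`. -/
def phase (φ : ℝ) (x : Fin 3 → ℝ) : ℝ := (x 0 ^ 2 + x 1 ^ 2) * phiCot φ + 4 * φ * x 2

lemma absolutelyContinuousOnInterval_comp {f g : ℝ → ℝ} {a b : ℝ} {s : Set ℝ} {K : NNReal}
    (hf : LipschitzOnWith K f s) (hg : AbsolutelyContinuousOnInterval g a b)
    (hs : ∀ x ∈ uIcc a b, g x ∈ s) : AbsolutelyContinuousOnInterval (fun x => f (g x)) a b := by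
  rw [absolutelyContinuousOnInterval_iff] at hg ⊢
  intro ε hε
  obtain ⟨δ, hδ, h⟩ := hg (ε / (K + 1)) (by positivity)
  refine ⟨δ, hδ, fun E hE hlt => ?_⟩
  have h1 := h E hE hlt
  calc _ ≤ ∑ i ∈ Finset.range E.1, (K : ℝ) * dist (g (E.2 i).1) (g (E.2 i).2) :=
        Finset.sum_le_sum fun i hi =>
          hf.dist_le_mul _ (hs _ (hE.1 i hi).1) _ (hs _ (hE.1 i hi).2)
    _ = K * ∑ i ∈ Finset.range E.1, dist (g (E.2 i).1) (g (E.2 i).2) := by rw [Finset.mul_sum]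
    _ ≤ K * (ε / (K + 1)) := by gcongr
    _ < (K + 1) * (ε / (K + 1)) := by gcongr; linarith
    _ = ε := by field

lemma neg_mul_le_deriv_action {a b c₀ c₁ k φ Q u Λ : ℝ} (hu : 0 ≤ u) (huu : u ^ 2 = c₀ ^ 2 + c₁ ^ 2)
    (hΛ : 0 < Λ) (hQ : k ^ 2 + φ ^ 2 = Q) :
    -(Λ * u) ≤ 2 * (a * c₀ + b * c₁) * k + (a ^ 2 + b ^ 2) * (Q * (u / Λ))
      + 2 * φ * (a * c₁ - b * c₀) := by
  obtain ⟨ρ, hρ⟩ : ∃ ρ, ρ = √((a ^ 2 + b ^ 2) * Q) := ⟨_, rfl⟩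
  have hQ0 : 0 ≤ Q := by rw [← hQ]; positivity
  have hρ0 : 0 ≤ ρ := by rw [hρ]; positivity
  have hρ2 : ρ ^ 2 = (a ^ 2 + b ^ 2) * Q := by rw [hρ, sq_sqrt (by positivity)]
  have h1 : -(u * ρ) ≤ c₀ * (a * k - φ * b) + c₁ * (b * k + φ * a) := by
    refine (abs_le_of_sq_le_sq' ?_ (by positivity)).1
    rw [mul_pow, huu, hρ2, ← hQ]
    nlinarith [sq_nonneg (c₀ * (b * k + φ * a) - c₁ * (a * k - φ * b))]
  have h2 : 0 ≤ u / Λ * (ρ - Λ) ^ 2 := by positivity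
  have h3 : u / Λ * (ρ - Λ) ^ 2 = (a ^ 2 + b ^ 2) * (Q * (u / Λ)) - 2 * u * ρ + Λ * u := by
    rw [← mul_assoc, ← hρ2]; field_simp; ring
  linarith

lemma heis_velocity (c : Fin 2 → ℝ) (y : Fin 3 → ℝ) :
    (∑ k, c k • heisA k y) = ![c 0, c 1, (y 0 * c 1 - y 1 * c 0) / 2] := by
  ext i
  fin_cases i <;> simp [Fin.sum_univ_two, heisA]
  ring

lemma phase_le_length_mul {γ : ℝ → Fin 3 → ℝ} {cf : ℝ → Fin 2 → ℝ} {K : NNReal}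
    (hLip : LipschitzOnWith K γ (Icc 0 1)) (h1 : γ 1 = 0)
    (hm : ∀ k, Measurable fun s => cf s k)
    (hd : ∀ᵐ s ∂(volume.restrict (Icc (0 : ℝ) 1)), HasDerivAt γ (∑ k, cf s k • heisA k (γ s)) s)
    {φ : ℝ} (hφ : φ ∈ Ioo (-π) π) (hφ0 : φ ≠ 0) {ε : ℝ} (hε : 0 < ε) :
    phase φ (γ 0) ≤ ((∫ s in Icc (0 : ℝ) 1, √(∑ k, cf s k ^ 2)) + ε) *
      ∫ s in Icc (0 : ℝ) 1, √(∑ k, cf s k ^ 2) := by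
  set u : ℝ → ℝ := fun s => √(∑ k, cf s k ^ 2) with hu_def
  have hu0 : ∀ s, 0 ≤ u s := fun s => sqrt_nonneg _
  have huu : ∀ s, u s ^ 2 = cf s 0 ^ 2 + cf s 1 ^ 2 := fun s => by
    rw [hu_def]; simp only [Fin.sum_univ_two]; rw [sq_sqrt (by positivity)]
  have hI : uIcc (0 : ℝ) 1 = Icc 0 1 := uIcc_of_le zero_le_one
  have hac : ∀ i, AbsolutelyContinuousOnInterval (fun s => γ s i) 0 1 := fun i =>
    LipschitzOnWith.absolutelyContinuousOnInterval (K := 1 * K)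
      (by rw [hI]; exact (LipschitzWith.eval i).comp_lipschitzOnWith hLip)
  have hd' : ∀ᵐ s, s ∈ Icc (0 : ℝ) 1 → HasDerivAt (fun s => γ s 0) (cf s 0) s ∧
      HasDerivAt (fun s => γ s 1) (cf s 1) s ∧
      HasDerivAt (fun s => γ s 2) ((γ s 0 * cf s 1 - γ s 1 * cf s 0) / 2) s := by
    filter_upwards [(ae_restrict_iff' measurableSet_Icc).1 hd] with s hs hs1
    have := hasDerivAt_pi.1 (hs hs1)
    rw [heis_velocity] at this
    exact ⟨by simpa using this 0, by simpa using this 1, by simpa using this 2⟩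
  have hcf : ∀ k, IntervalIntegrable (fun s => cf s k) volume 0 1 := by
    have h0 := (hac 0).intervalIntegrable_deriv
    have h1 := (hac 1).intervalIntegrable_deriv
    intro k
    fin_cases k
    · refine h0.congr_ae ?_
      rw [Filter.EventuallyEq, ae_restrict_iff' measurableSet_uIoc]
      filter_upwards [hd'] with s hs hs1
      exact (hs (hI ▸ uIoc_subset_uIcc hs1)).1.deriv
    · refine h1.congr_ae ?_
      rw [Filter.EventuallyEq, ae_restrict_iff' measurableSet_uIoc]
      filter_upwards [hd'] with s hs hs1
      exact (hs (hI ▸ uIoc_subset_uIcc hs1)).2.1.deriv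
  have hui : IntervalIntegrable u volume 0 1 := by
    refine ((hcf 0).abs.add (hcf 1).abs).mono_fun' ?_ ?_
    · refine Measurable.aestronglyMeasurable ?_
      exact (Finset.measurable_sum _ fun k _ => (hm k).pow_const 2).sqrt
    · refine Eventually.of_forall fun s => ?_
      simp only [norm_eq_abs, abs_of_nonneg (hu0 s)]
      refine abs_le_of_sq_le_sq' ?_ (by positivity) |>.2
      rw [huu]
      nlinarith [sq_abs (cf s 0), sq_abs (cf s 1), abs_nonneg (cf s 0), abs_nonneg (cf s 1),
        mul_nonneg (abs_nonneg (cf s 0)) (abs_nonneg (cf s 1))]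
  have hL : ∫ s in Icc (0 : ℝ) 1, u s = ∫ s in (0 : ℝ)..1, u s := by
    rw [intervalIntegral.integral_of_le zero_le_one, integral_Icc_eq_integral_Ioc]
  rw [hL]
  set L := ∫ s in (0 : ℝ)..1, u s with hLdef
  have hL0 : 0 ≤ L := intervalIntegral.integral_nonneg zero_le_one fun s _ => hu0 s
  have hΛ : 0 < L + ε := by linarith
  let M : ℝ → ℝ := fun s => ∫ v in (1 : ℝ)..s, u v
  have hM : ∀ s ∈ Icc (0 : ℝ) 1, -L ≤ M s ∧ M s ≤ 0 := by
    intro s hs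
    have hA : M s = -∫ v in s..1, u v := intervalIntegral.integral_symm _ _
    have hB : 0 ≤ ∫ v in s..1, u v := intervalIntegral.integral_nonneg hs.2 fun s _ => hu0 s
    have hC : ∫ v in s..1, u v ≤ L := by
      refine intervalIntegral.integral_mono_interval hs.1 hs.2 le_rfl
        (Eventually.of_forall hu0) hui
    constructor <;> linarith
  let τ : ℝ → ℝ := fun s => (ε - M s) * (1 / (L + ε))
  have hτ : ∀ s ∈ Icc (0 : ℝ) 1, τ s ∈ Icc (ε / (L + ε)) 1 := by
    intro s hs
    obtain ⟨hA, hB⟩ := hM s hs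
    simp only [τ, mul_one_div]
    constructor
    · gcongr; linarith
    · rw [div_le_one hΛ]; linarith
  have hτac : AbsolutelyContinuousOnInterval τ 0 1 := by
    have hMac : AbsolutelyContinuousOnInterval M 0 1 :=
      hui.absolutelyContinuousOnInterval_intervalIntegral (by simp)
    have h2 : AbsolutelyContinuousOnInterval (fun s => (-(1 / (L + ε))) * M s) 0 1 :=
      hMac.const_mul _
    have h3 : AbsolutelyContinuousOnInterval (fun _ : ℝ => ε * (1 / (L + ε))) 0 1 :=
      ((LipschitzWith.const _).lipschitzOnWith (s := uIcc 0 1)).absolutelyContinuousOnInterval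
    have := h3.add h2
    refine (congrArg (fun f => AbsolutelyContinuousOnInterval f 0 1) ?_).mp this
    ext s
    simp only [Pi.add_apply, τ]; ring
  let k : ℝ → ℝ := fun t => φ * cos (φ * t) / sin (φ * t)
  have hε1 : 0 < ε / (L + ε) := by positivity
  have hsin : ∀ t ∈ Icc (ε / (L + ε)) 1, sin (φ * t) ≠ 0 := by
    intro t ht
    have ht0 : 0 < t := hε1.trans_le ht.1
    refine sin_ne_zero_of_mem ?_ (mul_ne_zero hφ0 ht0.ne')
    rw [mem_Ioo, ← abs_lt, abs_mul, abs_of_pos ht0]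
    calc |φ| * t ≤ |φ| * 1 := by gcongr; exact ht.2
      _ < π := by rw [mul_one]; exact abs_lt.2 hφ
  have hkac : AbsolutelyContinuousOnInterval (fun s => k (τ s)) 0 1 := by
    have hk : ContDiffOn ℝ 1 k (Icc (ε / (L + ε)) 1) :=
      ContDiffOn.div (by fun_prop) (by fun_prop) hsin
    obtain ⟨C, hC⟩ := hk.exists_lipschitzOnWith (by decide) (convex_Icc _ _) isCompact_Icc
    exact absolutelyContinuousOnInterval_comp hC hτac (hI ▸ hτ)
  let V : ℝ → ℝ := fun s =>
    (γ s 0 * γ s 0 + γ s 1 * γ s 1) * k (τ s) + 4 * φ * γ s 2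
  have hVac : AbsolutelyContinuousOnInterval V 0 1 :=
    ((((hac 0).mul (hac 0)).add ((hac 1).mul (hac 1))).mul hkac).add ((hac 2).const_mul _)
  have hVd : ∀ᵐ s, s ∈ Icc (0 : ℝ) 1 → -((L + ε) * u s) ≤ deriv V s := by
    filter_upwards [hd', hui.ae_hasDerivAt_integral] with s hs hs' hs1
    obtain ⟨d0, d1, d2⟩ := hs hs1
    have hMd : HasDerivAt M (u s) s := hs' (hI ▸ hs1) 1 (by simp)
    have hτd : HasDerivAt τ (-u s * (1 / (L + ε))) s := (hMd.const_sub ε).mul_const _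
    have hsn := hsin _ (hτ s hs1)
    have hl : HasDerivAt (fun t : ℝ => φ * t) φ (τ s) := by
      simpa using (hasDerivAt_id (τ s)).const_mul φ
    have hkd : HasDerivAt k (-(φ / sin (φ * τ s)) ^ 2) (τ s) := by
      have := (hl.cos.const_mul φ).div hl.sin hsn
      refine this.congr_deriv ?_
      have h2 := sin_sq_add_cos_sq (φ * τ s)
      field_simp
      linear_combination (-1) * h2
    have hkτ := hkd.comp s hτd
    have hV : HasDerivAt V (((cf s 0 * γ s 0 + γ s 0 * cf s 0) +
        (cf s 1 * γ s 1 + γ s 1 * cf s 1)) * k (τ s) +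
        (γ s 0 * γ s 0 + γ s 1 * γ s 1) * (-(φ / sin (φ * τ s)) ^ 2 * (-u s * (1 / (L + ε))))
        + 4 * φ * ((γ s 0 * cf s 1 - γ s 1 * cf s 0) / 2)) s :=
      (((d0.mul d0).add (d1.mul d1)).mul hkτ).add (d2.const_mul (4 * φ))
    rw [hV.deriv]
    have hQ : k (τ s) ^ 2 + φ ^ 2 = (φ / sin (φ * τ s)) ^ 2 := by
      have h2 := sin_sq_add_cos_sq (φ * τ s)
      simp only [k]
      field_simp
      linear_combination h2
    refine (neg_mul_le_deriv_action (a := γ s 0) (b := γ s 1) (hu0 s) (huu s) hΛ hQ).trans_eq ?_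
    ring
  have hFTC := hVac.integral_deriv_eq_sub
  have hV1 : V 1 = 0 := by simp [V, h1]
  have hV0 : V 0 = phase φ (γ 0) := by
    have : τ 0 = 1 := by
      have : M 0 = -L := intervalIntegral.integral_symm _ _
      simp only [τ, this]; field_simp; ring
    have hkg : k 1 = phiCot φ := by
      have := (sinc_pos_of_mem hφ).ne'
      simp only [k, mul_one]
      rw [← sinc_mul_self, phiCot]; field_simp
    simp only [V, this, hkg, phase]; ring
  have hmono : ∫ s in (0 : ℝ)..1, -((L + ε) * u s) ≤ ∫ s in (0 : ℝ)..1, deriv V s := by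
    refine intervalIntegral.integral_mono_ae_restrict zero_le_one (hui.const_mul _).neg
      hVac.intervalIntegrable_deriv ?_
    exact (ae_restrict_iff' measurableSet_Icc).2 hVd
  rw [hFTC, hV1, hV0, intervalIntegral.integral_neg, intervalIntegral.integral_const_mul] at hmono
  linarith

lemma phase_le_length_sq {γ : ℝ → Fin 3 → ℝ} {cf : ℝ → Fin 2 → ℝ} {K : NNReal}
    (hLip : LipschitzOnWith K γ (Icc 0 1)) (h1 : γ 1 = 0)
    (hm : ∀ k, Measurable fun s => cf s k)
    (hd : ∀ᵐ s ∂(volume.restrict (Icc (0 : ℝ) 1)), HasDerivAt γ (∑ k, cf s k • heisA k (γ s)) s)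
    {φ : ℝ} (hφ : φ ∈ Ioo (-π) π) :
    phase φ (γ 0) ≤ (∫ s in Icc (0 : ℝ) 1, √(∑ k, cf s k ^ 2)) ^ 2 := by
  obtain ⟨L, hL⟩ : ∃ L, L = ∫ s in Icc (0 : ℝ) 1, √(∑ k, cf s k ^ 2) := ⟨_, rfl⟩
  have key : ∀ ψ ∈ Ioo (-π) π, ψ ≠ 0 → phase ψ (γ 0) ≤ L ^ 2 := by
    intro ψ hψ hψ0
    have ht : Tendsto (fun ε : ℝ => (L + ε) * L) (nhdsWithin 0 (Ioi 0)) (nhds (L ^ 2)) := by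
      have : Continuous fun ε : ℝ => (L + ε) * L := by fun_prop
      have := (this.tendsto 0).mono_left (nhdsWithin_le_nhds (s := Ioi 0))
      simpa [sq] using this
    refine ge_of_tendsto ht ?_
    filter_upwards [self_mem_nhdsWithin] with ε hε
    have := phase_le_length_mul hLip h1 hm hd hψ hψ0 hε
    rwa [← hL] at this
  rw [← hL]
  by_cases h0 : φ = 0
  · have ht : Tendsto (fun ψ => phase ψ (γ 0)) (nhdsWithin φ {φ}ᶜ) (nhds (phase φ (γ 0))) := by
      have hc : ContinuousAt phiCot φ := continuousOn_phiCot.continuousAt (Ioo_mem_nhds hφ.1 hφ.2)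
      have : ContinuousAt (fun ψ => phase ψ (γ 0)) φ := by
        unfold phase; fun_prop
      exact this.mono_left nhdsWithin_le_nhds
    refine le_of_tendsto ht ?_
    filter_upwards [self_mem_nhdsWithin, mem_nhdsWithin_of_mem_nhds (Ioo_mem_nhds hφ.1 hφ.2)]
      with ψ h1 h2
    exact key ψ h2 (by rw [h0] at h1; exact h1)
  · exact key φ hφ h0

/-- The lengths of admissible curves joining `x` to `y`. -/
def lengths (x y : Fin 3 → ℝ) : Set ℝ :=
  {L : ℝ | ∃ (γ : ℝ → Fin 3 → ℝ) (cf : ℝ → Fin 2 → ℝ) (K : NNReal),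
    LipschitzOnWith K γ (Set.Icc 0 1) ∧ γ 0 = x ∧ γ 1 = y ∧
    (∀ k, Measurable fun s => cf s k) ∧
    (∀ᵐ s ∂(volume.restrict (Set.Icc (0 : ℝ) 1)),
      HasDerivAt γ (∑ k, cf s k • heisA k (γ s)) s) ∧
    L = ∫ s in Set.Icc (0 : ℝ) 1, Real.sqrt (∑ k, cf s k ^ 2)}

lemma dH_eq_sInf (x : Fin 3 → ℝ) : dH x = sInf (lengths x 0) := rfl

lemma lengths_nonneg {x y : Fin 3 → ℝ} {L : ℝ} (h : L ∈ lengths x y) : 0 ≤ L := by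
  obtain ⟨γ, cf, K, -, -, -, -, -, rfl⟩ := h
  exact integral_nonneg fun _ => sqrt_nonneg _

lemma phase_le_sq_of_mem_lengths {x : Fin 3 → ℝ} {L φ : ℝ} (hφ : φ ∈ Ioo (-π) π)
    (h : L ∈ lengths x 0) : phase φ x ≤ L ^ 2 := by
  obtain ⟨γ, cf, K, h1, rfl, h2, h3, h4, rfl⟩ := h
  exact phase_le_length_sq h1 h2 h3 h4 hφ

lemma mem_lengths_of_contDiff {x y : Fin 3 → ℝ} {γ : ℝ → Fin 3 → ℝ} {c₀ c₁ : ℝ → ℝ} {L : ℝ}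
    (hγ : ContDiff ℝ 1 γ) (h0 : γ 0 = x) (h1 : γ 1 = y) (hc₀ : Continuous c₀) (hc₁ : Continuous c₁)
    (hd : ∀ s, HasDerivAt γ ![c₀ s, c₁ s, (γ s 0 * c₁ s - γ s 1 * c₀ s) / 2] s)
    (hL : 0 ≤ L) (hc : ∀ s, c₀ s ^ 2 + c₁ s ^ 2 = L ^ 2) : L ∈ lengths x y := by
  obtain ⟨K, hK⟩ := (hγ.contDiffOn (s := Icc 0 1)).exists_lipschitzOnWith (by decide)
    (convex_Icc _ _) isCompact_Icc
  refine ⟨γ, fun s => ![c₀ s, c₁ s], K, hK, h0, h1, fun k => ?_, ?_, ?_⟩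
  · fin_cases k
    · simpa using hc₀.measurable
    · simpa using hc₁.measurable
  · refine Eventually.of_forall fun s => ?_
    rw [heis_velocity]
    exact hd s
  · simp [Fin.sum_univ_two, hc, sqrt_sq hL]

lemma arc_mem_lengths {x : Fin 3 → ℝ} {φ : ℝ} (hφ : φ ∈ Ioo (-π) π)
    (h : 4 * x 2 = (x 0 ^ 2 + x 1 ^ 2) * areaRatio φ) :
    √(x 0 ^ 2 + x 1 ^ 2) / sinc φ ∈ lengths x 0 := by
  have hsinc := sinc_pos_of_mem hφ
  have hr : √(x 0 ^ 2 + x 1 ^ 2) ^ 2 = x 0 ^ 2 + x 1 ^ 2 := sq_sqrt (by positivity)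
  by_cases h0 : φ = 0
  · have hx2 : x 2 = 0 := by rw [h0, areaRatio_zero] at h; linarith
    refine mem_lengths_of_contDiff (γ := fun s => (1 - s) • x) (c₀ := fun _ => -x 0)
      (c₁ := fun _ => -x 1) (by fun_prop) (by simp) (by simp) (by fun_prop) (by fun_prop)
      (fun s => ?_) (by positivity) (fun s => ?_)
    · have : HasDerivAt (fun s : ℝ => (1 - s) • x) ((-1 : ℝ) • x) s :=
        ((hasDerivAt_id s).const_sub 1).smul_const x
      refine this.congr_deriv ?_
      ext i
      fin_cases i <;> simp [hx2]
      ring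
    · rw [h0, sinc_zero, div_one, hr]; ring
  have hs := sin_ne_zero_of_mem hφ h0
  have p1 := sin_sq_add_cos_sq φ
  let θ : ℝ → ℝ := fun s => φ * (1 - 2 * s)
  have hθ : ∀ s, HasDerivAt θ (-2 * φ) s := fun s => by
    have := (((hasDerivAt_id s).const_mul 2).const_sub 1).const_mul φ
    exact this.congr_deriv (by ring)
  have hθc : ContDiff ℝ 1 θ := by fun_prop
  let A : ℝ → ℝ := fun s => (sin (θ s) + sin φ) / (2 * sin φ)
  let B : ℝ → ℝ := fun s => (cos φ - cos (θ s)) / (2 * sin φ)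
  let Z : ℝ → ℝ := fun s => (x 0 ^ 2 + x 1 ^ 2) / (8 * sin φ ^ 2) * (θ s + φ - sin (θ s + φ))
  have hA : ∀ s, HasDerivAt A (-(φ / sin φ) * cos (θ s)) s := fun s =>
    (((hθ s).sin.add_const (sin φ)).div_const (2 * sin φ)).congr_deriv (by field_simp)
  have hB : ∀ s, HasDerivAt B (-(φ / sin φ) * sin (θ s)) s := fun s =>
    (((hθ s).cos.const_sub (cos φ)).div_const (2 * sin φ)).congr_deriv (by field_simp)
  have hZ : ∀ s, HasDerivAt Z ((x 0 ^ 2 + x 1 ^ 2) / (8 * sin φ ^ 2) *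
      (-2 * φ - cos (θ s + φ) * (-2 * φ))) s := fun s =>
    (((hθ s).add_const φ).sub ((hθ s).add_const φ).sin).const_mul _
  refine mem_lengths_of_contDiff
    (γ := fun s => ![A s * x 0 - B s * x 1, A s * x 1 + B s * x 0, Z s])
    (c₀ := fun s => -(φ / sin φ) * (cos (θ s) * x 0 - sin (θ s) * x 1))
    (c₁ := fun s => -(φ / sin φ) * (cos (θ s) * x 1 + sin (θ s) * x 0))
    ?_ ?_ ?_ (by fun_prop) (by fun_prop) (fun s => ?_) (by positivity) (fun s => ?_)
  · rw [contDiff_pi]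
    intro i
    fin_cases i
    · change ContDiff ℝ 1 fun s => A s * x 0 - B s * x 1
      fun_prop
    · change ContDiff ℝ 1 fun s => A s * x 1 + B s * x 0
      fun_prop
    · change ContDiff ℝ 1 Z
      fun_prop
  · have hA0 : A 0 = 1 := by simp only [A, θ]; norm_num; field_simp; norm_num
    have hB0 : B 0 = 0 := by simp [B, θ]
    have hZ0 : Z 0 = x 2 := by
      have : Z 0 = (x 0 ^ 2 + x 1 ^ 2) * areaRatio φ / 4 := by
        simp only [Z, θ, areaRatio]
        rw [show φ * (1 - 2 * 0) + φ = 2 * φ by ring, sin_two_mul]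
        field_simp; ring
      rw [this, ← h]; ring
    ext i
    fin_cases i <;> simp [hA0, hB0, hZ0]
  · have hθ1 : θ 1 = -φ := by simp only [θ]; ring
    have hA1 : A 1 = 0 := by simp [A, hθ1]
    have hB1 : B 1 = 0 := by simp [B, hθ1]
    have hZ1 : Z 1 = 0 := by simp [Z, hθ1]
    ext i
    fin_cases i <;> simp [hA1, hB1, hZ1]
  · rw [hasDerivAt_pi]
    intro i
    fin_cases i
    · exact (((hA s).mul_const (x 0)).sub ((hB s).mul_const (x 1))).congr_deriv
        (by simp only [Fin.zero_eta, Matrix.cons_val_zero]; ring)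
    · exact (((hA s).mul_const (x 1)).add ((hB s).mul_const (x 0))).congr_deriv
        (by simp only [Fin.mk_one, Matrix.cons_val_one, Matrix.cons_val_zero]; ring)
    · refine (hZ s).congr_deriv ?_
      have p2 := sin_sq_add_cos_sq (θ s)
      change _ = ((A s * x 0 - B s * x 1) * (-(φ / sin φ) * (cos (θ s) * x 1 + sin (θ s) * x 0)) -
        (A s * x 1 + B s * x 0) * (-(φ / sin φ) * (cos (θ s) * x 0 - sin (θ s) * x 1))) / 2
      simp only [A, B]
      rw [cos_add]
      field_simp
      linear_combination ((x 0 ^ 2 + x 1 ^ 2) * 8) * p2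
  · rw [div_pow, hr, ← sinc_mul_self] at *
    have p2 := sin_sq_add_cos_sq (θ s)
    field_simp
    linear_combination (x 0 ^ 2 + x 1 ^ 2) * p2

/-- The half-angle of the circular arc below the geodesic from the identity to `x`. -/
def geodesicAngle (x : Fin 3 → ℝ) : ℝ := halfAngle (4 * x 2 / (x 0 ^ 2 + x 1 ^ 2))

/-- The complement of the centre of the Heisenberg group. -/
def offCenter : Set (Fin 3 → ℝ) := {x | 0 < x 0 ^ 2 + x 1 ^ 2}

lemma isOpen_offCenter : IsOpen offCenter :=
  isOpen_lt continuous_const (by fun_prop)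

lemma geodesicAngle_mem (x : Fin 3 → ℝ) : geodesicAngle x ∈ Ioo (-π) π := halfAngle_mem _

lemma continuousAt_geodesicAngle {x : Fin 3 → ℝ} (hx : x ∈ offCenter) :
    ContinuousAt geodesicAngle x := by
  have : x 0 ^ 2 + x 1 ^ 2 ≠ 0 := hx.ne'
  have h : ContinuousAt (fun y : Fin 3 → ℝ => 4 * y 2 / (y 0 ^ 2 + y 1 ^ 2)) x :=
    (by fun_prop : Continuous fun y : Fin 3 → ℝ => 4 * y 2).continuousAt.div
      (by fun_prop : Continuous fun y : Fin 3 → ℝ => y 0 ^ 2 + y 1 ^ 2).continuousAt this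
  exact continuous_halfAngle.continuousAt.comp h

lemma mul_areaRatio_geodesicAngle {x : Fin 3 → ℝ} (hx : x ∈ offCenter) :
    4 * x 2 = (x 0 ^ 2 + x 1 ^ 2) * areaRatio (geodesicAngle x) := by
  have : x 0 ^ 2 + x 1 ^ 2 ≠ 0 := hx.ne'
  rw [geodesicAngle, areaRatio_halfAngle]; field_simp

lemma geodesicAngle_ne_zero {x : Fin 3 → ℝ} (hx : x ∈ offCenter) (h2 : x 2 ≠ 0) :
    geodesicAngle x ≠ 0 := fun h => h2 <| by
  have := mul_areaRatio_geodesicAngle hx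
  rw [h, areaRatio_zero] at this
  linarith

lemma phase_geodesicAngle {x : Fin 3 → ℝ} (hx : x ∈ offCenter) :
    phase (geodesicAngle x) x = (√(x 0 ^ 2 + x 1 ^ 2) / sinc (geodesicAngle x)) ^ 2 := by
  have h1 := phiCot_add_mul_areaRatio (geodesicAngle_mem x)
  have h2 := mul_areaRatio_geodesicAngle hx
  rw [div_pow, sq_sqrt hx.le, phase]
  linear_combination (x 0 ^ 2 + x 1 ^ 2) * h1 + geodesicAngle x * h2

lemma dH_eq {x : Fin 3 → ℝ} (hx : x ∈ offCenter) :
    dH x = √(x 0 ^ 2 + x 1 ^ 2) / sinc (geodesicAngle x) := by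
  have hmem := arc_mem_lengths (geodesicAngle_mem x) (mul_areaRatio_geodesicAngle hx)
  rw [dH_eq_sInf]
  refine le_antisymm (csInf_le ⟨0, fun L => lengths_nonneg⟩ hmem)
    (le_csInf ⟨_, hmem⟩ fun L hL => ?_)
  have := phase_le_sq_of_mem_lengths (geodesicAngle_mem x) hL
  rw [phase_geodesicAngle hx] at this
  exact le_of_sq_le_sq this (lengths_nonneg hL)

lemma dH_pos {x : Fin 3 → ℝ} (hx : x ∈ offCenter) : 0 < dH x := by
  rw [dH_eq hx]
  exact div_pos (sqrt_pos.2 hx) (sinc_pos_of_mem (geodesicAngle_mem x))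

lemma dH_sq {x : Fin 3 → ℝ} (hx : x ∈ offCenter) : dH x ^ 2 = phase (geodesicAngle x) x := by
  rw [dH_eq hx, phase_geodesicAngle hx]

lemma phase_le_dH_sq {x : Fin 3 → ℝ} (hx : x ∈ offCenter) {φ : ℝ} (hφ : φ ∈ Ioo (-π) π) :
    phase φ x ≤ dH x ^ 2 := by
  rw [dH_eq hx]
  exact phase_le_sq_of_mem_lengths hφ
    (arc_mem_lengths (geodesicAngle_mem x) (mul_areaRatio_geodesicAngle hx))

/-- The differential of `phase φ` at `x`. -/
def phaseDeriv (φ : ℝ) (x : Fin 3 → ℝ) : (Fin 3 → ℝ) →L[ℝ] ℝ :=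
  (2 * phiCot φ * x 0) • ContinuousLinearMap.proj 0 +
    (2 * phiCot φ * x 1) • ContinuousLinearMap.proj 1 + (4 * φ) • ContinuousLinearMap.proj 2

lemma hasFDerivAt_phase (φ : ℝ) (x : Fin 3 → ℝ) : HasFDerivAt (phase φ) (phaseDeriv φ x) x := by
  have h : ∀ i : Fin 3, HasFDerivAt (fun y : Fin 3 → ℝ => y i)
    (ContinuousLinearMap.proj (R := ℝ) (φ := fun _ : Fin 3 => ℝ) i) x := fun i =>
      hasFDerivAt_apply i x
  refine (((((h 0).pow 2).add ((h 1).pow 2)).mul_const (phiCot φ)).add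
    ((h 2).const_mul (4 * φ))).congr_fderiv ?_
  ext v
  simp [phaseDeriv]
  ring

lemma hasFDerivAt_dH_sq {x : Fin 3 → ℝ} (hx : x ∈ offCenter) :
    HasFDerivAt (fun y => dH y ^ 2) (phaseDeriv (geodesicAngle x) x) x := by
  have hΦ := continuousAt_geodesicAngle hx
  have hg : ContinuousAt (fun y => phiCot (geodesicAngle y)) x :=
    ContinuousAt.comp (continuousOn_phiCot.continuousAt
      (Ioo_mem_nhds (geodesicAngle_mem x).1 (geodesicAngle_mem x).2)) hΦ
  have hnhds := isOpen_offCenter.mem_nhds hx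
  have hrem : (fun y => dH y ^ 2 - phase (geodesicAngle x) y) =o[nhds x] fun y => y - x := by
    have hN : DifferentiableAt ℝ (fun y : Fin 3 → ℝ => y 0 ^ 2 + y 1 ^ 2) x := by fun_prop
    have hN2 : DifferentiableAt ℝ (fun y : Fin 3 → ℝ => y 2) x := by fun_prop
    have o1 : (fun y => (phiCot (geodesicAngle y) - phiCot (geodesicAngle x)) *
        ((y 0 ^ 2 + y 1 ^ 2) - (x 0 ^ 2 + x 1 ^ 2))) =o[nhds x] fun y => y - x := by
      have ha : (fun y => phiCot (geodesicAngle y) - phiCot (geodesicAngle x))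
          =o[nhds x] fun _ => (1 : ℝ) :=
        (Asymptotics.isLittleO_one_iff ℝ).2 (tendsto_sub_nhds_zero_iff.2 hg)
      have hb := ha.mul_isBigO hN.isBigO_sub.norm_right
      simp only [one_mul] at hb
      exact hb.of_norm_right
    have o2 : (fun y => 4 * (geodesicAngle y - geodesicAngle x) * (y 2 - x 2))
        =o[nhds x] fun y => y - x := by
      have ha : (fun y => 4 * (geodesicAngle y - geodesicAngle x)) =o[nhds x] fun _ => (1 : ℝ) :=
        ((Asymptotics.isLittleO_one_iff ℝ).2 (tendsto_sub_nhds_zero_iff.2 hΦ)).const_mul_left 4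
      have hb := ha.mul_isBigO hN2.isBigO_sub.norm_right
      simp only [one_mul] at hb
      exact hb.of_norm_right
    refine Asymptotics.IsBigO.trans_isLittleO (Asymptotics.IsBigO.of_bound 1 ?_) (o1.add o2)
    filter_upwards [hnhds] with y hy
    have h1 := phase_le_dH_sq hy (geodesicAngle_mem x)
    have h2 := phase_le_dH_sq hx (geodesicAngle_mem y)
    have h3 := dH_sq hx
    have h4 := dH_sq hy
    rw [one_mul, norm_eq_abs, norm_eq_abs, abs_of_nonneg (by linarith)]
    refine le_trans ?_ (le_abs_self _)
    rw [h4]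
    rw [h3] at h2
    simp only [phase] at h2 ⊢
    linarith
  have h := hasFDerivAt_phase (geodesicAngle x) x
  rw [hasFDerivAt_iff_isLittleO] at h ⊢
  refine (h.add hrem).congr_left fun y => ?_
  rw [dH_sq hx]; ring

lemma hasFDerivAt_dH {x : Fin 3 → ℝ} (hx : x ∈ offCenter) :
    HasFDerivAt dH ((1 / (2 * dH x)) • phaseDeriv (geodesicAngle x) x) x := by
  have h0 : dH x ^ 2 ≠ 0 := (pow_pos (dH_pos hx) 2).ne'
  have := (hasFDerivAt_dH_sq hx).sqrt h0
  rw [sqrt_sq (dH_pos hx).le] at this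
  refine this.congr_of_eventuallyEq ?_
  filter_upwards [isOpen_offCenter.mem_nhds hx] with y hy
  rw [sqrt_sq (dH_pos hy).le]

lemma gradSq_dH {x : Fin 3 → ℝ} (hx : x ∈ offCenter) : gradSq heisA dH x = 1 := by
  have h1 := sq_add_phiCot_sq (geodesicAngle_mem x)
  have h2 : dH x ^ 2 = (x 0 ^ 2 + x 1 ^ 2) * (1 / sinc (geodesicAngle x)) ^ 2 := by
    rw [dH_eq hx, div_pow, sq_sqrt hx.le]; ring
  have h0 := (dH_pos hx).ne'
  simp only [gradSq, Xop, (hasFDerivAt_dH hx).fderiv, Fin.sum_univ_two, Fin.sum_univ_three, heisA,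
    phaseDeriv]
  simp
  field_simp
  rw [h2, ← h1]
  ring

lemma mem_offCenter {x : Fin 3 → ℝ} (hx : ¬(x 0 = 0 ∧ x 1 = 0)) : x ∈ offCenter := by
  rw [offCenter, mem_ofPred_eq]
  by_contra! h
  exact hx ⟨by nlinarith [sq_nonneg (x 0), sq_nonneg (x 1)],
    by nlinarith [sq_nonneg (x 0), sq_nonneg (x 1)]⟩

/-- The time-`t` flow of the left-invariant vector field `heisA k`. -/
def shift (k : Fin 2) (t : ℝ) (x : Fin 3 → ℝ) : Fin 3 → ℝ := x + t • heisA k x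

lemma heisA_shift (k : Fin 2) (t : ℝ) (x : Fin 3 → ℝ) : heisA k (shift k t x) = heisA k x := by
  fin_cases k <;> simp [shift, heisA]

lemma shift_shift (k : Fin 2) (s t : ℝ) (x : Fin 3 → ℝ) :
    shift k s (shift k t x) = shift k (s + t) x := by
  rw [shift, heisA_shift, shift, shift, add_assoc, ← add_smul, add_comm t s]

@[simp] lemma shift_zero (k : Fin 2) (x : Fin 3 → ℝ) : shift k 0 x = x := by simp [shift]

lemma contDiff_heisA (k : Fin 2) : ContDiff ℝ (⊤ : ℕ∞) (heisA k) := by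
  rw [contDiff_pi]
  intro i
  fin_cases k <;> fin_cases i <;> simp [heisA] <;> fun_prop

lemma continuous_shift (k : Fin 2) :
    Continuous fun p : ℝ × (Fin 3 → ℝ) => shift k p.1 p.2 := by
  have := (contDiff_heisA k).continuous
  unfold shift
  fun_prop

/-- `shift k t` as a homeomorphism. -/
def shiftHomeo (k : Fin 2) (t : ℝ) : (Fin 3 → ℝ) ≃ₜ (Fin 3 → ℝ) where
  toFun := shift k t
  invFun := shift k (-t)
  left_inv x := by simp [shift_shift]
  right_inv x := by simp [shift_shift]
  continuous_toFun := (continuous_shift k).comp (Continuous.prodMk_right t)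
  continuous_invFun := (continuous_shift k).comp (Continuous.prodMk_right (-t))

lemma measurableEmbedding_shift (k : Fin 2) (t : ℝ) : MeasurableEmbedding (shift k t) :=
  (shiftHomeo k t).measurableEmbedding

lemma measurePreserving_shift (k : Fin 2) (t : ℝ) :
    MeasurePreserving (shift k t) volume volume := by
  fin_cases k
  · have h1 := Real.volume_preserving_transvectionStruct
      (⟨2, 1, by decide, -t / 2⟩ : Matrix.TransvectionStruct (Fin 3) ℝ)
    have h2 := (measurePreserving_add_right volume (![t, 0, 0] : Fin 3 → ℝ)).comp h1
    have : shift ((fun i => i) ⟨0, by decide⟩) t = (fun x => x + ![t, 0, 0]) ∘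
        Matrix.toLin' (⟨2, 1, by decide, -t / 2⟩ :
          Matrix.TransvectionStruct (Fin 3) ℝ).toMatrix := by
      ext x i
      fin_cases i <;>
        simp [shift, heisA, Matrix.transvection, Matrix.single_mulVec, Matrix.vecHead,
          Matrix.vecTail]
      ring
    rw [this]
    exact h2
  · have h1 := Real.volume_preserving_transvectionStruct
      (⟨2, 0, by decide, t / 2⟩ : Matrix.TransvectionStruct (Fin 3) ℝ)
    have h2 := (measurePreserving_add_right volume (![0, t, 0] : Fin 3 → ℝ)).comp h1
    have : shift ((fun i => i) ⟨1, by decide⟩) t = (fun x => x + ![0, t, 0]) ∘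
        Matrix.toLin' (⟨2, 0, by decide, t / 2⟩ :
          Matrix.TransvectionStruct (Fin 3) ℝ).toMatrix := by
      ext x i
      fin_cases i <;>
        simp [shift, heisA, Matrix.transvection, Matrix.single_mulVec, Matrix.vecHead,
          Matrix.vecTail]
      ring
    rw [this]
    exact h2

lemma two_mul_le_of_sq_add_sq_le {A B D E a b t : ℝ} (hA : 0 ≤ A) (hB : 0 ≤ B)
    (h : D ^ 2 + E ^ 2 ≤ A * B) :
    2 * t * (a * D - b * E) ≤ (a ^ 2 + b ^ 2) * A + t ^ 2 * B := by
  refine le_of_sq_le_sq ?_ (by positivity)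
  have h1 : (a * D - b * E) ^ 2 ≤ (a ^ 2 + b ^ 2) * (A * B) := by
    nlinarith [sq_nonneg (a * E + b * D),
      mul_le_mul_of_nonneg_left h (by positivity : 0 ≤ a ^ 2 + b ^ 2)]
  nlinarith [sq_nonneg ((a ^ 2 + b ^ 2) * A - t ^ 2 * B),
    mul_le_mul_of_nonneg_left h1 (by positivity : 0 ≤ 4 * t ^ 2)]

lemma dH_sq_second_difference_le {k : Fin 2} {t : ℝ} {x : Fin 3 → ℝ} (hx : x ∈ offCenter)
    (hp : shift k t x ∈ offCenter) (hp2 : shift k t x 2 ≠ 0)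
    (hq : shift k (-t) x ∈ offCenter) (hq2 : shift k (-t) x 2 ≠ 0) :
    dH (shift k t x) ^ 2 + dH (shift k (-t) x) ^ 2 - 2 * dH x ^ 2 ≤ 8 * t ^ 2 := by
  have hpm := geodesicAngle_mem (shift k t x)
  have hqm := geodesicAngle_mem (shift k (-t) x)
  have hp0 := geodesicAngle_ne_zero hp hp2
  have hq0 := geodesicAngle_ne_zero hq hq2
  rw [dH_sq hp, dH_sq hq]
  generalize geodesicAngle (shift k t x) = p at hpm hp0 ⊢
  generalize geodesicAngle (shift k (-t) x) = q at hqm hq0 ⊢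
  have hm := phase_le_dH_sq hx (φ := (p + q) / 2)
    ⟨by linarith [hpm.1, hqm.1], by linarith [hpm.2, hqm.2]⟩
  obtain ⟨hA, hDE⟩ := phiCot_midpoint hpm hqm hp0 hq0
  have hB : 0 ≤ 8 - phiCot p - phiCot q := by linarith [phiCot_le_one hpm, phiCot_le_one hqm]
  fin_cases k
  · have := two_mul_le_of_sq_add_sq_le (a := x 0) (b := x 1) (t := t) hA hB hDE
    simp only [phase, shift, heisA] at hm ⊢
    simp
    linarith
  · have := two_mul_le_of_sq_add_sq_le (a := x 1) (b := -x 0) (t := t) hA hB hDE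
    simp only [phase, shift, heisA] at hm ⊢
    simp
    linarith

lemma dH_second_difference_le {k : Fin 2} {t : ℝ} {x : Fin 3 → ℝ} (hx : x ∈ offCenter)
    (hp : shift k t x ∈ offCenter) (hp2 : shift k t x 2 ≠ 0)
    (hq : shift k (-t) x ∈ offCenter) (hq2 : shift k (-t) x 2 ≠ 0) :
    dH (shift k t x) + dH (shift k (-t) x) - 2 * dH x ≤ t ^ 2 * (4 / dH x) := by
  have h := dH_sq_second_difference_le hx hp hp2 hq hq2
  have h0 := dH_pos hx
  rw [← mul_div_assoc, le_div_iff₀ h0]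
  nlinarith [sq_nonneg (dH (shift k t x) - dH x), sq_nonneg (dH (shift k (-t) x) - dH x)]

lemma ae_ne_zero (i : Fin 3) : ∀ᵐ x : Fin 3 → ℝ, x i ≠ 0 :=
  Measure.ae_eval_ne (fun _ => volume) i 0

lemma ae_mem_offCenter : ∀ᵐ x : Fin 3 → ℝ, x ∈ offCenter := by
  filter_upwards [ae_ne_zero 0] with x h0 using mem_offCenter fun h => h0 h.1

lemma ae_dH_second_difference_le (k : Fin 2) (t : ℝ) : ∀ᵐ x : Fin 3 → ℝ,
    dH (shift k t x) + dH (shift k (-t) x) - 2 * dH x ≤ t ^ 2 * (4 / dH x) := by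
  have h := fun s => (measurePreserving_shift k s).quasiMeasurePreserving.ae
    (ae_mem_offCenter.and (ae_ne_zero 2))
  filter_upwards [ae_mem_offCenter, h t, h (-t)] with x hx hp hq using
    dH_second_difference_le hx hp.1 hp.2 hq.1 hq.2

lemma aestronglyMeasurable_dH : AEStronglyMeasurable dH (volume : Measure (Fin 3 → ℝ)) := by
  have h : ContinuousOn dH offCenter := fun x hx =>
    (hasFDerivAt_dH hx).continuousAt.continuousWithinAt
  have := h.aestronglyMeasurable (μ := volume) isOpen_offCenter.measurableSet
  rwa [Measure.restrict_eq_self_of_ae_mem ae_mem_offCenter] at this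

lemma dH_le {x : Fin 3 → ℝ} (hx : x ∈ offCenter) :
    dH x ≤ √(x 0 ^ 2 + x 1 ^ 2 + 4 * π * |x 2|) := by
  refine le_sqrt_of_sq_le ?_
  rw [dH_sq hx, phase]
  have hΦ := geodesicAngle_mem x
  have h1 := phiCot_le_one hΦ
  have h2 : |geodesicAngle x| ≤ π := (abs_lt.2 hΦ).le
  have h3 : geodesicAngle x * x 2 ≤ π * |x 2| := by
    refine (le_abs_self _).trans ?_
    rw [abs_mul]
    gcongr
  nlinarith [mul_le_mul_of_nonneg_left h1 hx.le]

lemma sqrt_le_dH {x : Fin 3 → ℝ} (hx : x ∈ offCenter) : √(x 0 ^ 2 + x 1 ^ 2) ≤ dH x := by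
  refine sqrt_le_iff.2 ⟨(dH_pos hx).le, ?_⟩
  have := phase_le_dH_sq hx (φ := 0) ⟨by linarith [pi_pos], pi_pos⟩
  simpa [phase, phiCot_zero] using this

lemma locallyIntegrable_dH : LocallyIntegrable dH (volume : Measure (Fin 3 → ℝ)) := by
  have hc : Continuous fun x : Fin 3 → ℝ => √(x 0 ^ 2 + x 1 ^ 2 + 4 * π * |x 2|) := by fun_prop
  refine hc.locallyIntegrable.mono aestronglyMeasurable_dH ?_
  filter_upwards [ae_mem_offCenter] with x hx
  rw [norm_eq_abs, norm_eq_abs, abs_of_pos (dH_pos hx), abs_of_nonneg (sqrt_nonneg _)]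
  exact dH_le hx

lemma integrableOn_abs_rpow (R : ℝ) :
    IntegrableOn (fun s : ℝ => |s| ^ (-1 / 2 : ℝ)) (Icc (-R) R) := by
  rcases lt_or_ge R 0 with hR | hR
  · simp [Icc_eq_empty_of_lt (show R < -R by linarith)]
  have h : IntegrableOn (fun s : ℝ => |s| ^ (-1 / 2 : ℝ)) (Icc 0 R) := by
    have := (intervalIntegrable_iff_integrableOn_Icc_of_le hR).1
      (intervalIntegral.intervalIntegrable_rpow' (r := (-1 / 2 : ℝ)) (by norm_num))
    refine this.congr_fun (fun s hs => ?_) measurableSet_Icc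
    simp only [abs_of_nonneg hs.1]
  have h' : IntegrableOn (fun s : ℝ => |s| ^ (-1 / 2 : ℝ)) (Icc (-R) 0) := by
    have := h.comp_neg
    simpa using this
  rw [← Icc_union_Icc_eq_Icc (neg_nonpos.2 hR) hR]
  exact h'.union h

lemma locallyIntegrable_inv_dH :
    LocallyIntegrable (fun x => (dH x)⁻¹) (volume : Measure (Fin 3 → ℝ)) := by
  let f : Fin 3 → ℝ → ℝ :=
    ![fun s => |s| ^ (-1 / 2 : ℝ), fun s => |s| ^ (-1 / 2 : ℝ), fun _ => 1]
  have hf : LocallyIntegrable (fun x : Fin 3 → ℝ => ∏ i, f i (x i)) volume := by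
    rw [locallyIntegrable_iff]
    intro K hK
    obtain ⟨R, hR⟩ := hK.isBounded.subset_closedBall 0
    have hsub : K ⊆ Set.univ.pi fun _ : Fin 3 => Icc (-R) R := fun x hx i _ => by
      have := (norm_le_pi_norm x i).trans (mem_closedBall_zero_iff.1 (hR hx))
      exact abs_le.1 this
    refine IntegrableOn.mono_set ?_ hsub
    rw [IntegrableOn, volume_pi, Measure.restrict_pi_pi]
    refine Integrable.fintype_prod fun i => ?_
    fin_cases i
    · exact integrableOn_abs_rpow R
    · exact integrableOn_abs_rpow R
    · exact integrable_const _
  refine hf.mono aestronglyMeasurable_dH.inv₀ ?_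
  filter_upwards [ae_ne_zero 0, ae_ne_zero 1] with x h0 h1
  have hx := mem_offCenter fun h => h0 h.1
  have hr : 0 < √(x 0 ^ 2 + x 1 ^ 2) := sqrt_pos.2 hx
  have ha : 0 < |x 0| * |x 1| := by positivity
  have hle : (|x 0| * |x 1|) ^ (1 / 2 : ℝ) ≤ √(x 0 ^ 2 + x 1 ^ 2) := by
    rw [← sqrt_eq_rpow]
    refine sqrt_le_sqrt ?_
    rw [← sq_abs (x 0), ← sq_abs (x 1)]
    nlinarith [sq_nonneg (|x 0| - |x 1|)]
  simp only [Fin.prod_univ_three, f, Matrix.cons_val_zero, Matrix.cons_val_one, Matrix.cons_val,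
    mul_one]
  rw [← mul_rpow (abs_nonneg _) (abs_nonneg _), norm_inv, norm_eq_abs, norm_eq_abs,
    abs_of_pos (dH_pos hx), abs_of_pos (rpow_pos_of_pos ha _), neg_div, rpow_neg ha.le]
  exact inv_anti₀ (rpow_pos_of_pos ha _) (hle.trans (sqrt_le_dH hx))

lemma Xop_eq_fderiv (a : (Fin 3 → ℝ) → Fin 3 → ℝ) (f : (Fin 3 → ℝ) → ℝ) (x : Fin 3 → ℝ) :
    Xop a f x = fderiv ℝ f x (a x) := by
  conv_rhs => rw [← Finset.univ_sum_single (a x), map_sum]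
  refine Finset.sum_congr rfl fun j _ => ?_
  rw [← smul_eq_mul, ← map_smul, ← Pi.single_smul, smul_eq_mul, mul_one]

lemma contDiff_Xop {ψ : (Fin 3 → ℝ) → ℝ} (hψ : ContDiff ℝ (⊤ : ℕ∞) ψ) (k : Fin 2) :
    ContDiff ℝ (⊤ : ℕ∞) (Xop (heisA k) ψ) := by
  have h : ContDiff ℝ (⊤ : ℕ∞) fun x => fderiv ℝ ψ x (heisA k x) :=
    (hψ.fderiv_right (m := (⊤ : ℕ∞)) (by simp)).clm_apply (contDiff_heisA k)
  rwa [← funext fun x => Xop_eq_fderiv (heisA k) ψ x] at h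

lemma hasCompactSupport_Xop {ψ : (Fin 3 → ℝ) → ℝ} (hψ : HasCompactSupport ψ) (k : Fin 2) :
    HasCompactSupport (Xop (heisA k) ψ) := by
  refine (hψ.fderiv ℝ).mono fun x hx => ?_
  rw [Function.mem_support, Xop_eq_fderiv] at hx
  rw [Function.mem_support]
  intro h
  simp [h] at hx

lemma hasDerivAt_comp_shift {ψ : (Fin 3 → ℝ) → ℝ} (hψ : ContDiff ℝ (⊤ : ℕ∞) ψ) (k : Fin 2)
    (x : Fin 3 → ℝ) (s : ℝ) :
    HasDerivAt (fun s => ψ (shift k s x)) (Xop (heisA k) ψ (shift k s x)) s := by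
  have h1 : HasDerivAt (fun s => shift k s x) (heisA k x) s := by
    have := ((hasDerivAt_id s).smul_const (heisA k x)).const_add x
    rwa [one_smul] at this
  have h2 := ((hψ.differentiable (by simp)) (shift k s x)).hasFDerivAt
  rw [Xop_eq_fderiv, heisA_shift]
  exact h2.comp_hasDerivAt s h1

lemma exists_second_difference_eq {f f₁ f₂ : ℝ → ℝ} (h1 : ∀ s, HasDerivAt f (f₁ s) s)
    (h2 : ∀ s, HasDerivAt f₁ (f₂ s) s) {t : ℝ} (ht : 0 < t) :
    ∃ ξ ∈ Ioo (-t) t, f t + f (-t) - 2 * f 0 = t ^ 2 * f₂ ξ := by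
  have hg : ∀ s, HasDerivAt (fun s => f s + f (-s)) (f₁ s - f₁ (-s)) s := fun s => by
    have := (h1 s).add ((h1 (-s)).scomp s (hasDerivAt_neg s))
    exact this.congr_deriv (by simp; ring)
  have hsq : ∀ s : ℝ, HasDerivAt (fun s => s ^ 2) (2 * s) s := fun s => by
    simpa using hasDerivAt_pow 2 s
  obtain ⟨c, hc, hcg⟩ := exists_ratio_hasDerivAt_eq_ratio_slope _ _ ht
    (fun s _ => (hg s).continuousAt.continuousWithinAt) (fun s _ => hg s) _ _
    (fun s _ => (hsq s).continuousAt.continuousWithinAt) (fun s _ => hsq s)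
  obtain ⟨ξ, hξ, hξs⟩ := exists_hasDerivAt_eq_slope f₁ f₂ (a := -c) (b := c) (by linarith [hc.1])
    (fun s _ => (h2 s).continuousAt.continuousWithinAt) (fun s _ => h2 s)
  refine ⟨ξ, ⟨by linarith [hξ.1, hc.2], by linarith [hξ.2, hc.2]⟩, ?_⟩
  have hc0 := hc.1
  rw [eq_div_iff (by linarith)] at hξs
  rw [← hξs] at hcg
  refine mul_right_cancel₀ (show 2 * c ≠ 0 by positivity) ?_
  simp only [neg_zero] at hcg
  linarith

lemma integral_dH_mul_comp_shift (k : Fin 2) (t : ℝ) (ψ : (Fin 3 → ℝ) → ℝ) :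
    ∫ x, dH x * ψ (shift k t x) = ∫ x, dH (shift k (-t) x) * ψ x := by
  have := (measurePreserving_shift k t).integral_comp (measurableEmbedding_shift k t)
    (fun x => dH (shift k (-t) x) * ψ x)
  simpa [shift_shift] using this

lemma integrable_dH_mul {ψ : (Fin 3 → ℝ) → ℝ} (hψ : Continuous ψ) (hc : HasCompactSupport ψ) :
    Integrable fun x => dH x * ψ x := by
  simpa using locallyIntegrable_dH.integrable_smul_right_of_hasCompactSupport hψ hc

lemma integrable_dH_mul_comp_shift {ψ : (Fin 3 → ℝ) → ℝ} (hψ : Continuous ψ)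
    (hc : HasCompactSupport ψ) (k : Fin 2) (t : ℝ) :
    Integrable fun x => dH x * ψ (shift k t x) :=
  integrable_dH_mul (hψ.comp (shiftHomeo k t).continuous) (hc.comp_homeomorph (shiftHomeo k t))

lemma integrable_dH_comp_shift_mul {ψ : (Fin 3 → ℝ) → ℝ} (hψ : Continuous ψ)
    (hc : HasCompactSupport ψ) (k : Fin 2) (t : ℝ) :
    Integrable fun x => dH (shift k t x) * ψ x := by
  have := ((measurePreserving_shift k t).integrable_comp_emb (measurableEmbedding_shift k t)).2
    (integrable_dH_mul_comp_shift hψ hc k (-t))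
  refine this.congr (Eventually.of_forall fun x => ?_)
  simp [shift_shift]

lemma integrable_div_dH_mul {ψ : (Fin 3 → ℝ) → ℝ} (hψ : Continuous ψ) (hc : HasCompactSupport ψ)
    (K : ℝ) : Integrable fun x => K / dH x * ψ x := by
  have := (locallyIntegrable_inv_dH.integrable_smul_right_of_hasCompactSupport hψ hc).const_mul K
  refine this.congr (Eventually.of_forall fun x => ?_)
  simp only [smul_eq_mul]
  ring

lemma integral_dH_mul_second_difference_le {ψ : (Fin 3 → ℝ) → ℝ} (hψ : Continuous ψ)
    (hc : HasCompactSupport ψ) (h0 : ∀ x, 0 ≤ ψ x) (k : Fin 2) {t : ℝ} (ht : 0 < t) :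
    ∫ x, dH x * ((ψ (shift k t x) + ψ (shift k (-t) x) - 2 * ψ x) / t ^ 2) ≤
      ∫ x, 4 / dH x * ψ x := by
  have e1 : ∫ x, dH x * ((ψ (shift k t x) + ψ (shift k (-t) x) - 2 * ψ x) / t ^ 2) =
      (∫ x, (dH x * ψ (shift k t x) + dH x * ψ (shift k (-t) x) - 2 * (dH x * ψ x))) / t ^ 2 := by
    rw [← integral_div]
    refine integral_congr_ae (Eventually.of_forall fun x => ?_)
    ring
  have i0 := integrable_dH_mul hψ hc
  have i1 := integrable_dH_mul_comp_shift hψ hc k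
  have i2 := integrable_dH_comp_shift_mul hψ hc k
  have i3 : Integrable fun x => dH x * ψ (shift k t x) + dH x * ψ (shift k (-t) x) :=
    (i1 t).add (i1 (-t))
  have i4 : Integrable fun x => dH (shift k (-t) x) * ψ x + dH (shift k t x) * ψ x :=
    (i2 (-t)).add (i2 t)
  have e2 : ∫ x, (dH x * ψ (shift k t x) + dH x * ψ (shift k (-t) x) - 2 * (dH x * ψ x)) =
      ∫ x, (dH (shift k (-t) x) * ψ x + dH (shift k t x) * ψ x - 2 * (dH x * ψ x)) := by
    rw [integral_sub i3 (i0.const_mul 2), integral_add (i1 t) (i1 (-t)),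
      integral_sub i4 (i0.const_mul 2), integral_add (i2 (-t)) (i2 t),
      integral_dH_mul_comp_shift, integral_dH_mul_comp_shift, neg_neg]
  rw [e1, e2, div_le_iff₀ (by positivity), ← integral_mul_const]
  refine integral_mono_ae (i4.sub (i0.const_mul 2))
    ((integrable_div_dH_mul hψ hc 4).mul_const _) ?_
  filter_upwards [ae_dH_second_difference_le k t] with x hx
  have := mul_le_mul_of_nonneg_right hx (h0 x)
  linarith

lemma integral_dH_mul_Xop_Xop_le {ψ : (Fin 3 → ℝ) → ℝ} (hψ : ContDiff ℝ (⊤ : ℕ∞) ψ)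
    (hc : HasCompactSupport ψ) (h0 : ∀ x, 0 ≤ ψ x) (k : Fin 2) :
    ∫ x, dH x * Xop (heisA k) (Xop (heisA k) ψ) x ≤ ∫ x, 4 / dH x * ψ x := by
  have hX := (contDiff_Xop (contDiff_Xop hψ k) k).continuous
  have hXc := hasCompactSupport_Xop (hasCompactSupport_Xop hc k) k
  set X := Xop (heisA k) (Xop (heisA k) ψ) with hXdef
  obtain ⟨C, hC⟩ := hXc.exists_bound_of_continuous hX
  have mv : ∀ (x : Fin 3 → ℝ) {t : ℝ}, 0 < t → ∃ ξ ∈ Ioo (-t) t,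
      (ψ (shift k t x) + ψ (shift k (-t) x) - 2 * ψ x) / t ^ 2 = X (shift k ξ x) := by
    intro x t ht
    obtain ⟨ξ, hξ, h⟩ := exists_second_difference_eq (hasDerivAt_comp_shift hψ k x)
      (hasDerivAt_comp_shift (contDiff_Xop hψ k) k x) ht
    refine ⟨ξ, hξ, ?_⟩
    rw [shift_zero] at h
    rw [h, mul_div_cancel_left₀ _ (by positivity)]
  let K := Set.image (fun p : ℝ × (Fin 3 → ℝ) => shift k p.1 p.2) (Icc (-1) 1 ×ˢ tsupport X)
  have hK : IsCompact K := (isCompact_Icc.prod hXc).image (continuous_shift k)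
  have hpos : ∀ n : ℕ, 0 < 1 / ((n : ℝ) + 1) := fun n => by positivity
  have hlim := tendsto_one_div_add_atTop_nhds_zero_nat (𝕜 := ℝ)
  have key : Tendsto (fun n : ℕ => ∫ x, dH x * ((ψ (shift k (1 / ((n : ℝ) + 1)) x) +
      ψ (shift k (-(1 / ((n : ℝ) + 1))) x) - 2 * ψ x) / (1 / ((n : ℝ) + 1)) ^ 2)) atTop
      (nhds (∫ x, dH x * X x)) := by
    refine tendsto_integral_of_dominated_convergence (K.indicator fun x => ‖dH x‖ * C)
      (fun n => ?_) ?_ (fun n => Eventually.of_forall fun x => ?_)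
      (Eventually.of_forall fun x => ?_)
    · have c1 := hψ.continuous.comp (shiftHomeo k (1 / ((n : ℝ) + 1))).continuous
      have c2 := hψ.continuous.comp (shiftHomeo k (-(1 / ((n : ℝ) + 1)))).continuous
      exact aestronglyMeasurable_dH.mul (((c1.add c2).sub
        (continuous_const.mul hψ.continuous)).div_const _).aestronglyMeasurable
    · rw [integrable_indicator_iff hK.measurableSet]
      exact ((locallyIntegrable_dH.integrableOn_isCompact hK).norm).mul_const C
    · obtain ⟨ξ, hξ, h⟩ := mv x (hpos n)
      rw [h, norm_mul]
      by_cases hx : x ∈ K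
      · rw [indicator_of_mem hx]
        exact mul_le_mul_of_nonneg_left (hC _) (norm_nonneg _)
      · rw [indicator_of_notMem hx]
        have : X (shift k ξ x) = 0 := by
          by_contra hne
          refine hx ⟨(-ξ, shift k ξ x), ⟨?_, subset_tsupport _ hne⟩, by simp [shift_shift]⟩
          have : 1 / ((n : ℝ) + 1) ≤ 1 := by
            rw [div_le_one (by positivity)]
            linarith [n.cast_nonneg (α := ℝ)]
          exact ⟨by linarith [hξ.2], by linarith [hξ.1]⟩
        simp [this]
    · choose ξ hξ h using fun n : ℕ => mv x (hpos n)
      simp only [h]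
      have hξ0 : Tendsto ξ atTop (nhds 0) :=
        tendsto_of_tendsto_of_tendsto_of_le_of_le (by simpa using hlim.neg) hlim
          (fun n => (hξ n).1.le) fun n => (hξ n).2.le
      have hcont : Continuous fun s => X (shift k s x) :=
        hX.comp ((continuous_shift k).comp (Continuous.prodMk_left x))
      have := (hcont.tendsto 0).comp hξ0
      rw [shift_zero] at this
      exact this.const_mul _
  exact le_of_tendsto' key fun n =>
    integral_dH_mul_second_difference_le hψ.continuous hc h0 k (hpos n)

end Heisenberg

/-- Proposition 1.1 of the paper: on the Heisenberg group `ℍ₁`,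
the Carnot–Carathéodory distance to the identity satisfies `‖∇d‖ = 1` away from the
centre `{x₁ = x₂ = 0}`, and `Δd ≤ K/d` in the sense of distributions. -/
theorem heisenberg_CC_distance_properties :
    (∀ x : Fin 3 → ℝ, ¬(x 0 = 0 ∧ x 1 = 0) →
      DifferentiableAt ℝ dH x ∧ gradSq heisA dH x = 1) ∧
    ∃ K : ℝ, 0 < K ∧
      ∀ ψ : (Fin 3 → ℝ) → ℝ, ContDiff ℝ (⊤ : ℕ∞) ψ → HasCompactSupport ψ → (∀ x, 0 ≤ ψ x) →
        ∫ x, dH x * subLap heisA ψ x ≤ ∫ x, K / dH x * ψ x := by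
  refine ⟨fun x hx => ⟨(Heisenberg.hasFDerivAt_dH (Heisenberg.mem_offCenter hx)).differentiableAt,
    Heisenberg.gradSq_dH (Heisenberg.mem_offCenter hx)⟩, 8, by norm_num, fun ψ hψ hc h0 => ?_⟩
  have hi := fun k => Heisenberg.integrable_dH_mul
    (Heisenberg.contDiff_Xop (Heisenberg.contDiff_Xop hψ k) k).continuous
    (Heisenberg.hasCompactSupport_Xop (Heisenberg.hasCompactSupport_Xop hc k) k)
  have h4 := Heisenberg.integrable_div_dH_mul hψ.continuous hc 4
  calc ∫ x, dH x * subLap heisA ψ x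
      = (∫ x, dH x * Xop (heisA 0) (Xop (heisA 0) ψ) x) +
          ∫ x, dH x * Xop (heisA 1) (Xop (heisA 1) ψ) x := by
        rw [← integral_add (hi 0) (hi 1)]
        simp only [subLap, Fin.sum_univ_two, mul_add]
    _ ≤ (∫ x, 4 / dH x * ψ x) + ∫ x, 4 / dH x * ψ x :=
        add_le_add (Heisenberg.integral_dH_mul_Xop_Xop_le hψ hc h0 0)
          (Heisenberg.integral_dH_mul_Xop_Xop_le hψ hc h0 1)
    _ = ∫ x, 8 / dH x * ψ x := by
        rw [← integral_add h4 h4]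
        refine integral_congr_ae (Eventually.of_forall fun x => ?_)
        ring
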